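/- (Lemma 1: splitting formula for the discriminant, stated as a determinant identity.) Let I and J be nonempty finite index sets, let M be a symmetric matrix with integer entries indexed by the disjoint union I ⊔ J, and suppose there are distinguished indices c₁ ∈ I and c₂ ∈ J such that the off-diagonal block of M between I and J vanishes except for the single entry M(c₁, c₂) = M(c₂, c₁) = 1. Write M_I and M_J for the diagonal blocks of M on I and J, and M_{I∖c₁}, M_{J∖c₂} for the submatrices of these blocks obtained by deleting the row and column of c₁, respectively c₂. Then det(−M) = det(−M_I)·det(−M_J) − det(−M_{I∖c₁})·det(−M_{J∖c₂}). (Geometrically: if T₁, T₂ are reduced snc-divisors with T₁·T₂ = 1 meeting in components C₁ ⊆ T₁, C₂ ⊆ T₂, and d(T) := det(−[Tᵢ·Tⱼ]) is the discriminant, then d(T₁+T₂) = d(T₁)d(T₂) − d(T₁−C₁)d(T₂−C₂).) -/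

import Mathlib

open Matrix

/-- Replacing a row by a multiple of the basis vector on the diagonal deletes that row and column
from the determinant. -/
theorem Matrix.det_updateRow_single_self {n R : Type*} [Fintype n] [DecidableEq n] [CommRing R]
    (A : Matrix n n R) (i : n) (c : R) :
    (A.updateRow i (Pi.single i c)).det =
      c * (A.submatrix (fun k : {k // k ≠ i} => k.1) (fun k : {k // k ≠ i} => k.1)).det := by
  rw [twoBlockTriangular_det' _ (fun k => k = i) (by
    rintro k rfl l hl
    simp [hl])]
  congr 1
  · convert! det_eq_elem_of_subsingleton
      ((A.updateRow i (Pi.single i c)).toSquareBlockProp (· = i)) ⟨i, rfl⟩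
    simp [toSquareBlockProp]
  · congr 1
    ext k l
    simp [toSquareBlockProp, updateRow_ne k.2]

/-- Determinant of a block matrix whose off-diagonal blocks each have a single, mutually transposed
entry. -/
theorem Matrix.det_fromBlocks_single_single {m n R : Type*} [Fintype m] [Fintype n]
    [DecidableEq m] [DecidableEq n] [CommRing R]
    (A : Matrix m m R) (D : Matrix n n R) (i : m) (j : n) (b c : R) :
    (fromBlocks A (single i j b) (single j i c) D).det =
      A.det * D.det -
        b * c * ((A.submatrix (fun k : {k // k ≠ i} => k.1) (fun k : {k // k ≠ i} => k.1)).det *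
          (D.submatrix (fun k : {k // k ≠ j} => k.1) (fun k : {k // k ≠ j} => k.1)).det) := by
  set N := fromBlocks A (single i j b) (single j i c) D
  have hrow : N = N.updateRow (Sum.inl i) (Sum.elim (A i) 0 + Pi.single (Sum.inr j) b) := by
    ext k l
    obtain rfl | hk := eq_or_ne k (Sum.inl i)
    · rcases l with l | l <;> simp [N, single_apply, Pi.single_apply, eq_comm]
    · rw [updateRow_ne hk]
  have htri : N.updateRow (Sum.inl i) (Sum.elim (A i) 0) =
      fromBlocks A 0 (single j i c) D := by
    ext (k | k) (l | l)
    · by_cases hk : k = i <;> simp [N, updateRow_apply, hk]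
    · obtain rfl | hk := eq_or_ne k i
      · simp
      · simp [N, updateRow_apply, hk, hk.symm]
    · simp [N]
    · simp [N]
  have hswap : (N.updateRow (Sum.inl i) (Pi.single (Sum.inr j) b)).submatrix
      (Equiv.swap (Sum.inl i) (Sum.inr j)) id =
      fromBlocks (A.updateRow i (Pi.single i c)) ((0 : Matrix m n R).updateRow i (D j)) 0
        (D.updateRow j (Pi.single j b)) := by
    ext (k | k) l
    · obtain rfl | hk := eq_or_ne k i
      · rcases l with l | l <;> simp [N, updateRow_apply, single_apply, Pi.single_apply, eq_comm]
      · rw [submatrix_apply, Equiv.swap_apply_of_ne_of_ne (by simpa using hk) (by simp)]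
        rcases l with l | l <;> simp [N, updateRow_apply, hk, hk.symm]
    · obtain rfl | hk := eq_or_ne k j
      · rcases l with l | l <;> simp [Pi.single_apply]
      · rw [submatrix_apply, Equiv.swap_apply_of_ne_of_ne (by simp) (by simpa using hk)]
        rcases l with l | l <;> simp [N, updateRow_apply, hk, hk.symm]
  have hdet := congrArg det hswap
  rw [det_permute, det_fromBlocks_zero₂₁, det_updateRow_single_self,
    det_updateRow_single_self, Equiv.Perm.sign_swap (by simp)] at hdet
  rw [hrow, det_updateRow_add, htri, det_fromBlocks_zero₁₂]
  push_cast at hdet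
  linear_combination -hdet

/-- **Lemma 1 (splitting formula for the discriminant), as a determinant identity.**
Let `M` be a symmetric integer matrix indexed by a disjoint union `I ⊕ J` of nonempty
finite sets, whose off-diagonal block between `I` and `J` vanishes except for a single
entry equal to `1` in position `(c₁, c₂)`. Then
`det(−M) = det(−M_I)·det(−M_J) − det(−M_{I∖c₁})·det(−M_{J∖c₂})`,
where `M_I`, `M_J` are the diagonal blocks and `M_{I∖c₁}`, `M_{J∖c₂}` are obtained by
deleting the row and column of `c₁`, resp. `c₂`. Geometrically this is
`d(T₁+T₂) = d(T₁)d(T₂) − d(T₁−C₁)d(T₂−C₂)` for snc-divisors with `T₁·T₂ = 1`. -/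
theorem discriminant_splitting
    {I J : Type*} [Fintype I] [Fintype J] [DecidableEq I] [DecidableEq J]
    [Nonempty I] [Nonempty J]
    (M : Matrix (I ⊕ J) (I ⊕ J) ℤ) (hsymm : M.IsSymm)
    (c₁ : I) (c₂ : J)
    (hoff : ∀ (i : I) (j : J),
      M (Sum.inl i) (Sum.inr j) = if i = c₁ ∧ j = c₂ then 1 else 0) :
    (-M).det =
      (-(M.submatrix Sum.inl Sum.inl)).det * (-(M.submatrix Sum.inr Sum.inr)).det
      - (-(M.submatrix (fun i : {i : I // i ≠ c₁} => Sum.inl i.1)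
            (fun i : {i : I // i ≠ c₁} => Sum.inl i.1))).det
        * (-(M.submatrix (fun j : {j : J // j ≠ c₂} => Sum.inr j.1)
            (fun j : {j : J // j ≠ c₂} => Sum.inr j.1))).det := by
  have hblocks : -M = fromBlocks (-(M.submatrix Sum.inl Sum.inl)) (single c₁ c₂ (-1))
      (single c₂ c₁ (-1)) (-(M.submatrix Sum.inr Sum.inr)) := by
    ext (k | k) (l | l)
    · simp
    · simp only [neg_apply, hoff, fromBlocks_apply₁₂, single_apply]
      grind
    · simp only [neg_apply, ← hsymm.apply (Sum.inr k), hoff, fromBlocks_apply₂₁, single_apply]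
      grind
    · simp
  rw [hblocks, det_fromBlocks_single_single]
  simp only [mul_neg, mul_one, neg_neg, one_mul]
  rfl
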